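/- If γ ≤ 1/2 or P = 0, then 𝔠₁ ≤ C·δ^{−1}·L^{2(d−γ)}·(1 + δL^{2γ}P)^{−1}; if γ > 1/2 and P ≠ 0, then 𝔠₁ ≤ C·δ^{−2}·L^{2(d−γ)}·min( (LP)^{−1} + L^{−(2−2γ)}, L^{−10η} ). In all cases 𝔠₁ ≤ C·δ^{−1}·L^{2(d−γ)}·𝔛^{−1}. -/

import Mathlib

open scoped RealInnerProductSpace BigOperators

noncomputable section

/-- The rescaled lattice `ℤ_L^d = (L⁻¹ℤ)^d` inside `ℝ^d`. -/
def ZLat (d : ℕ) (L : ℝ) : Set (EuclideanSpace ℝ (Fin d)) :=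
  {x | ∀ i, ∃ m : ℤ, x i = (m : ℝ) / L}

/-- The counting quantity `𝔠₁`. -/
def count1 (d : ℕ) (L δ γ α β : ℝ) (r x0 y0 : EuclideanSpace ℝ (Fin d))
    (ξ : EuclideanSpace ℝ (Fin d) → EuclideanSpace ℝ (Fin d) → EuclideanSpace ℝ (Fin d)) : ℕ :=
  Set.ncard {p : EuclideanSpace ℝ (Fin d) × EuclideanSpace ℝ (Fin d) |
    p.1 ∈ ZLat d L ∧ p.2 ∈ ZLat d L ∧ ‖p.1 - x0‖ ≤ 1 ∧ ‖p.2 - y0‖ ≤ 1 ∧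
    |⟪p.1, p.2⟫ - α| ≤ δ⁻¹ * L ^ (-(2 * γ)) ∧
    |⟪r, ξ p.1 p.2⟫ - β| ≤ δ⁻¹ * L ^ (-(2 * γ))}

open Finset in
/-- A linear form in two integer variables takes values in `[-N, N]` at few points of a box. -/
lemma card_filter_abs_linear_le (K N : ℕ) (a b : ℤ) (ha : a ≠ 0) (haK : |a| ≤ K) :
    ((#{p ∈ Icc (-(K : ℤ)) K ×ˢ Icc (-(K : ℤ)) K | |a * p.1 + b * p.2| ≤ N} : ℕ) : ℝ) ≤
      5 * K * (2 * N + Int.gcd a b) / |(a : ℝ)| := by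
  set s := {p ∈ Icc (-(K : ℤ)) K ×ˢ Icc (-(K : ℤ)) K | |a * p.1 + b * p.2| ≤ N} with hs
  set g := Int.gcd a b with hg
  have hgpos : 0 < g := Int.gcd_pos_of_ne_zero_left _ ha
  have hgz : (0 : ℤ) < g := by exact_mod_cast hgpos
  obtain ⟨a', ha'⟩ : (g : ℤ) ∣ a := Int.gcd_dvd_left _ _
  obtain ⟨b', hb'⟩ : (g : ℤ) ∣ b := Int.gcd_dvd_right _ _
  have hcop : IsCoprime a' b' := by
    have h := Int.gcd_eq_gcd_ab a b
    rw [← hg] at h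
    refine ⟨Int.gcdA a b, Int.gcdB a b, ?_⟩
    have h2 : (g : ℤ) * (Int.gcdA a b * a' + Int.gcdB a b * b') = g * 1 := by
      linear_combination -h - Int.gcdA a b * ha' - Int.gcdB a b * hb'
    exact mul_left_cancel₀ hgz.ne' h2
  have ha'0 : a' ≠ 0 := by rintro rfl; simp at ha'; exact ha ha'
  have hmem : ∀ p ∈ s, (a' * p.1 + b' * p.2) ∈ Icc (-((N / g : ℕ) : ℤ)) ((N / g : ℕ) : ℤ) := by
    intro p hp
    have h := (mem_filter.1 hp).2
    rw [mem_Icc, ← abs_le]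
    push_cast
    rw [Int.le_ediv_iff_mul_le hgz]
    calc |a' * p.1 + b' * p.2| * (g : ℤ) = |(a' * p.1 + b' * p.2) * g| := by
          rw [abs_mul, abs_of_pos hgz]
      _ = |a * p.1 + b * p.2| := by congr 1; rw [ha', hb']; ring
      _ ≤ N := h
  have hfib : ∀ v ∈ Icc (-((N / g : ℕ) : ℤ)) ((N / g : ℕ) : ℤ),
      #{p ∈ s | a' * p.1 + b' * p.2 = v} ≤ 2 * (2 * K / a'.natAbs) + 1 := by
    intro v _
    rcases ({p ∈ s | a' * p.1 + b' * p.2 = v}).eq_empty_or_nonempty with he | ⟨p0, hp0⟩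
    · rw [he]; simp
    have hc : #(Icc (-((2 * K / a'.natAbs : ℕ) : ℤ)) ((2 * K / a'.natAbs : ℕ) : ℤ)) =
        2 * (2 * K / a'.natAbs) + 1 := by
      rw [Int.card_Icc]; omega
    rw [← hc]
    have hdvd : ∀ p ∈ ({p ∈ s | a' * p.1 + b' * p.2 = v}), a' ∣ p.2 - p0.2 := by
      intro p hp
      have h1 := (mem_filter.1 hp).2
      have h2 := (mem_filter.1 hp0).2
      have h3 : a' ∣ b' * (p.2 - p0.2) := ⟨p0.1 - p.1, by linarith⟩
      exact hcop.dvd_of_dvd_mul_left h3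
    refine card_le_card_of_injOn (fun p => (p.2 - p0.2) / a') ?_ ?_
    · intro p hp
      have hp := mem_coe.1 hp
      obtain ⟨t, ht⟩ := hdvd p hp
      have h1 := mem_product.1 (mem_filter.1 (mem_filter.1 hp).1).1
      have h2 := mem_product.1 (mem_filter.1 (mem_filter.1 hp0).1).1
      have h3 := mem_Icc.1 h1.2
      have h4 := mem_Icc.1 h2.2
      rw [mem_coe, mem_Icc, ← abs_le]
      simp only [ht, Int.mul_ediv_cancel_left _ ha'0]
      have h5 : |a'| * |t| ≤ 2 * K := by
        rw [← abs_mul, ← ht, abs_le]; constructor <;> linarith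
      push_cast
      rw [Int.le_ediv_iff_mul_le (abs_pos.2 ha'0), mul_comm]
      exact h5
    · intro p hp q hq hpq
      have hp := mem_coe.1 hp
      have hq := mem_coe.1 hq
      obtain ⟨t, ht⟩ := hdvd p hp
      obtain ⟨u, hu⟩ := hdvd q hq
      simp only [ht, hu, Int.mul_ediv_cancel_left _ ha'0] at hpq
      have e2 : p.2 = q.2 := by
        rw [hpq] at ht; linarith
      have h1 := (mem_filter.1 hp).2
      have h2 := (mem_filter.1 hq).2
      have e1 : a' * p.1 = a' * q.1 := by rw [e2] at h1; linarith
      exact Prod.ext (mul_left_cancel₀ ha'0 e1) e2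
  have key := card_le_mul_card_image_of_maps_to hmem _ hfib
  have hc : #(Icc (-((N / g : ℕ) : ℤ)) ((N / g : ℕ) : ℤ)) = 2 * (N / g) + 1 := by
    rw [Int.card_Icc]; omega
  rw [hc] at key
  have hgR : (0 : ℝ) < g := by exact_mod_cast hgpos
  have haR : |(a : ℝ)| = g * (a'.natAbs : ℝ) := by
    rw [ha', Int.cast_mul, abs_mul, Nat.cast_natAbs]; simp
  have hnR : (0 : ℝ) < a'.natAbs := by exact_mod_cast Int.natAbs_pos.2 ha'0
  have hKa : |(a : ℝ)| ≤ K := by exact_mod_cast haK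
  have hapos : 0 < |(a : ℝ)| := by rw [haR]; positivity
  have d1 : ((2 * K / a'.natAbs : ℕ) : ℝ) ≤ 2 * K / a'.natAbs := by
    have := @Nat.cast_div_le ℝ _ _ _ (2 * K) a'.natAbs
    push_cast at this
    exact_mod_cast this
  have d2 : ((N / g : ℕ) : ℝ) ≤ N / g := Nat.cast_div_le
  have d3 : (1 : ℝ) ≤ K / a'.natAbs := by
    rw [le_div_iff₀ hnR]
    have : (1 : ℝ) ≤ g := by exact_mod_cast hgpos
    nlinarith
  have keyR : ((#s : ℕ) : ℝ) ≤ (2 * ((2 * K / a'.natAbs : ℕ) : ℝ) + 1) * (2 * ((N / g : ℕ) : ℝ) + 1) := by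
    exact_mod_cast key
  calc ((#s : ℕ) : ℝ) ≤ (2 * ((2 * K / a'.natAbs : ℕ) : ℝ) + 1) * (2 * ((N / g : ℕ) : ℝ) + 1) := keyR
    _ ≤ (5 * (K / a'.natAbs)) * (2 * (N / g) + 1) := by
        gcongr
        have : (2 * K / a'.natAbs : ℝ) = 2 * (K / a'.natAbs) := by ring
        linarith
    _ = _ := by rw [haR]; field_simp

open Finset in
lemma sum_card_divisors_le (K : ℕ) :
    ∑ a ∈ Icc 1 K, ((#a.divisors : ℕ) : ℝ) ≤ K * (1 + Real.log K) := by
  have h1 : ∀ a ∈ Icc 1 K, ((#a.divisors : ℕ) : ℝ) = ∑ h ∈ Icc 1 K, if h ∣ a then (1 : ℝ) else 0 := by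
    intro a ha
    rw [← sum_filter, sum_const, nsmul_eq_mul, mul_one]
    congr 2
    ext h
    have := mem_Icc.1 ha
    simp only [Nat.mem_divisors, mem_filter, mem_Icc]
    constructor
    · rintro ⟨h1, h2⟩
      exact ⟨⟨Nat.pos_of_dvd_of_pos h1 (by omega), (Nat.le_of_dvd (by omega) h1).trans this.2⟩, h1⟩
    · rintro ⟨_, h1⟩
      exact ⟨h1, by omega⟩
  rw [sum_congr rfl h1, sum_comm]
  have h2 : ∀ h ∈ Icc 1 K, (∑ a ∈ Icc 1 K, if h ∣ a then (1 : ℝ) else 0) ≤ K * (h : ℝ)⁻¹ := by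
    intro h _
    rw [← sum_filter, sum_const, nsmul_eq_mul, mul_one]
    have : #{a ∈ Icc 1 K | h ∣ a} = K / h := by
      have := Nat.Ioc_filter_dvd_card_eq_div K h
      rwa [← Finset.Icc_add_one_left_eq_Ioc] at this
    rw [this, ← div_eq_mul_inv]
    exact Nat.cast_div_le
  refine (sum_le_sum h2).trans ?_
  rw [← mul_sum]
  have := harmonic_le_one_add_log K
  rw [harmonic_eq_sum_Icc] at this
  push_cast at this
  gcongr

open Finset in
lemma sum_gcd_le (a : ℕ) (ha : 0 < a) :
    ∑ b ∈ Icc (-(a : ℤ)) a, ((Int.gcd a b : ℕ) : ℝ) ≤ 3 * a * #a.divisors := by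
  have h1 : ∀ b ∈ Icc (-(a : ℤ)) a, ((Int.gcd a b : ℕ) : ℝ) ≤
      ∑ h ∈ a.divisors, if (h : ℤ) ∣ b then (h : ℝ) else 0 := by
    intro b _
    have hm : Int.gcd a b ∈ a.divisors := by
      rw [Nat.mem_divisors]
      refine ⟨?_, ha.ne'⟩
      exact_mod_cast Int.gcd_dvd_left (a := (a : ℤ)) (b := b)
    refine le_trans (le_of_eq ?_) (single_le_sum (f := fun h : ℕ => if (h : ℤ) ∣ b then (h : ℝ) else 0)
      (fun i _ => by positivity) hm)
    simp only [Int.gcd_dvd_right, if_true]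
  refine (sum_le_sum h1).trans ?_
  rw [sum_comm]
  have h2 : ∀ h ∈ a.divisors, (∑ b ∈ Icc (-(a : ℤ)) a, if (h : ℤ) ∣ b then (h : ℝ) else 0) ≤ 3 * a := by
    intro h hh
    obtain ⟨⟨c, hc⟩, _⟩ := Nat.mem_divisors.1 hh
    have hpos : 0 < h := Nat.pos_of_mem_divisors hh
    rw [← sum_filter, sum_const, nsmul_eq_mul]
    have hcard : #{b ∈ Icc (-(a : ℤ)) a | (h : ℤ) ∣ b} ≤ 2 * c + 1 := by
      have e : #(Icc (-(c : ℤ)) c) = 2 * c + 1 := by rw [Int.card_Icc]; omega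
      rw [← e]
      have hz : (0 : ℤ) < h := by exact_mod_cast hpos
      have hc' : (a : ℤ) = h * c := by exact_mod_cast hc
      refine card_le_card_of_injOn (fun b => b / h) ?_ ?_
      · intro b hb
        have hb := mem_filter.1 (mem_coe.1 hb)
        obtain ⟨t, rfl⟩ := hb.2
        have := mem_Icc.1 hb.1
        rw [mem_coe, mem_Icc]
        simp only [Int.mul_ediv_cancel_left _ hz.ne']
        rw [hc'] at this
        constructor <;> nlinarith
      · intro b hb b' hb' hbb
        obtain ⟨t, rfl⟩ := (mem_filter.1 (mem_coe.1 hb)).2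
        obtain ⟨t', rfl⟩ := (mem_filter.1 (mem_coe.1 hb')).2
        simp only [Int.mul_ediv_cancel_left _ hz.ne'] at hbb
        rw [hbb]
    have hc1 : 1 ≤ c := by
      rcases Nat.eq_zero_or_pos c with rfl | h
      · simp at hc; omega
      · exact h
    have : ((#{b ∈ Icc (-(a : ℤ)) a | (h : ℤ) ∣ b} : ℕ) : ℝ) ≤ 3 * c := by
      exact_mod_cast hcard.trans (by omega)
    calc _ ≤ 3 * (c : ℝ) * h := by gcongr
      _ = 3 * a := by rw [hc]; push_cast; ring
  refine (sum_le_sum h2).trans ?_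
  rw [sum_const, nsmul_eq_mul]
  linarith

open Finset in
lemma sum_Icc_neg_natAbs_le (K : ℕ) (f : ℕ → ℝ) (hf : ∀ n, 0 ≤ f n) :
    ∑ a ∈ Icc (-(K : ℤ)) K with a ≠ 0, f a.natAbs ≤ 2 * ∑ n ∈ Icc 1 K, f n := by
  have hmap : ∀ a ∈ ({a ∈ Icc (-(K : ℤ)) K | a ≠ 0}), a.natAbs ∈ Icc 1 K := by
    intro a ha
    have h := mem_filter.1 ha
    have := mem_Icc.1 h.1
    rw [mem_Icc]
    have := h.2
    omega
  rw [← sum_fiberwise_of_maps_to hmap, mul_sum]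
  refine sum_le_sum fun n _ => ?_
  rw [sum_congr rfl (g := fun _ => f n) (fun a ha => by rw [(mem_filter.1 ha).2]), sum_const,
    nsmul_eq_mul]
  have hcard : #{a ∈ ({a ∈ Icc (-(K : ℤ)) K | a ≠ 0}) | a.natAbs = n} ≤ 2 := by
    refine le_trans (card_le_card (t := {(n : ℤ), -(n : ℤ)}) ?_) card_le_two
    intro a ha
    have := (mem_filter.1 ha).2
    simp only [mem_insert, mem_singleton]
    omega
  have := hf n
  gcongr
  exact_mod_cast hcard

open Finset in
lemma sum_linear_majorant_le (K N : ℕ) :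
    ∑ a ∈ Icc (-(K : ℤ)) K, ∑ b ∈ Icc (-(K : ℤ)) K,
      (if a ≠ 0 ∧ |b| ≤ |a| then 5 * K * (2 * N + Int.gcd a b) / |(a : ℝ)| else 0) ≤
      30 * (K : ℝ) ^ 2 * (2 * N + 1 + Real.log K) := by
  have h1 : ∀ a ∈ Icc (-(K : ℤ)) K, ∑ b ∈ Icc (-(K : ℤ)) K,
      (if a ≠ 0 ∧ |b| ≤ |a| then 5 * K * (2 * N + Int.gcd a b) / |(a : ℝ)| else 0) ≤
      if a ≠ 0 then 15 * (K : ℝ) * (2 * N + #a.natAbs.divisors) else 0 := by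
    intro a ha
    by_cases h0 : a = 0
    · simp [h0]
    have ha := mem_Icc.1 ha
    have hn : 0 < a.natAbs := Int.natAbs_pos.2 h0
    have hnR : (0 : ℝ) < a.natAbs := by exact_mod_cast hn
    have habs : |(a : ℝ)| = a.natAbs := by rw [Nat.cast_natAbs]; simp
    have hs : ({b ∈ Icc (-(K : ℤ)) K | |b| ≤ |a|}) = Icc (-(a.natAbs : ℤ)) a.natAbs := by
      ext b
      simp only [mem_filter, mem_Icc, abs_le, Int.natCast_natAbs]
      constructor
      · tauto
      · rintro ⟨h1, h2⟩
        have : |a| ≤ K := abs_le.2 ha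
        exact ⟨⟨by linarith, by linarith⟩, h1, h2⟩
    simp only [ne_eq, h0, not_false_eq_true, true_and, if_true]
    rw [← sum_filter, hs, ← sum_div, ← mul_sum, sum_add_distrib, sum_const, habs]
    have hc : #(Icc (-(a.natAbs : ℤ)) a.natAbs) = 2 * a.natAbs + 1 := by rw [Int.card_Icc]; omega
    have hg := sum_gcd_le a.natAbs hn
    have hg' : ∑ b ∈ Icc (-(a.natAbs : ℤ)) a.natAbs, ((Int.gcd a b : ℕ) : ℝ) ≤
        3 * a.natAbs * #a.natAbs.divisors := by
      refine le_trans (le_of_eq (sum_congr rfl fun b _ => ?_)) hg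
      rw [Int.gcd_eq_natAbs, Int.gcd_eq_natAbs, Int.natAbs_natCast]
    rw [hc, nsmul_eq_mul, div_le_iff₀ hnR]
    have h1R : (1 : ℝ) ≤ a.natAbs := by exact_mod_cast hn
    calc _ ≤ 5 * (K : ℝ) * ((3 * a.natAbs) * (2 * N) + 3 * a.natAbs * #a.natAbs.divisors) := by
          gcongr
          push_cast
          linarith
      _ = _ := by ring
  refine (sum_le_sum h1).trans ?_
  rw [← sum_filter]
  refine (sum_Icc_neg_natAbs_le K (fun n => 15 * (K : ℝ) * (2 * N + #n.divisors))
    (fun n => by positivity)).trans ?_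
  rw [← mul_sum, sum_add_distrib, sum_const, nsmul_eq_mul]
  have := sum_card_divisors_le K
  simp only [Nat.card_Icc, add_tsub_cancel_right]
  calc _ ≤ 2 * (15 * (K : ℝ) * (K * (2 * N) + K * (1 + Real.log K))) := by gcongr
    _ = _ := by ring

open Finset in
/-- Number of integer solutions of `|a x + b y| ≤ N` with all four variables in `[-K, K]`. -/
lemma sum_card_filter_abs_linear_le (K N : ℕ) (hK : 1 ≤ K) :
    ∑ c ∈ Icc (-(K : ℤ)) K ×ˢ Icc (-(K : ℤ)) K,
      ((#{p ∈ Icc (-(K : ℤ)) K ×ˢ Icc (-(K : ℤ)) K | |c.1 * p.1 + c.2 * p.2| ≤ N} : ℕ) : ℝ) ≤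
      140 * (K : ℝ) ^ 2 * (N + 1 + Real.log K) := by
  set F : ℤ → ℤ → ℝ := fun a b =>
    if a ≠ 0 ∧ |b| ≤ |a| then 5 * K * (2 * N + Int.gcd a b) / |(a : ℝ)| else 0 with hF
  have hF0 : ∀ a b, 0 ≤ F a b := fun a b => by simp only [hF]; positivity
  have hKR : (1 : ℝ) ≤ K := by exact_mod_cast hK
  have hT : ∀ c ∈ Icc (-(K : ℤ)) K ×ˢ Icc (-(K : ℤ)) K,
      ((#{p ∈ Icc (-(K : ℤ)) K ×ˢ Icc (-(K : ℤ)) K | |c.1 * p.1 + c.2 * p.2| ≤ N} : ℕ) : ℝ) ≤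
      (if c = 0 then 9 * (K : ℝ) ^ 2 else 0) + (F c.1 c.2 + F c.2 c.1) := by
    rintro ⟨a, b⟩ hc
    have hc := mem_product.1 hc
    have haK : |a| ≤ K := abs_le.2 (mem_Icc.1 hc.1)
    have hbK : |b| ≤ K := abs_le.2 (mem_Icc.1 hc.2)
    by_cases h0 : (a, b) = 0
    · have h9 : ((#{p ∈ Icc (-(K : ℤ)) K ×ˢ Icc (-(K : ℤ)) K | |a * p.1 + b * p.2| ≤ N} : ℕ) : ℝ)
          ≤ 9 * (K : ℝ) ^ 2 := by
        have h := card_filter_le (Icc (-(K : ℤ)) K ×ˢ Icc (-(K : ℤ)) K)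
          (fun p => |a * p.1 + b * p.2| ≤ N)
        have e : #(Icc (-(K : ℤ)) K) = 2 * K + 1 := by rw [Int.card_Icc]; omega
        rw [card_product, e] at h
        have h2 : (2 * K + 1) * (2 * K + 1) ≤ 9 * K ^ 2 := by nlinarith
        exact_mod_cast h.trans h2
      rw [if_pos h0]
      have := hF0 a b
      have := hF0 b a
      simp only
      linarith
    rw [if_neg h0, zero_add]
    simp only
    rcases le_total |b| |a| with hab | hab
    · have ha : a ≠ 0 := by
        rintro rfl
        rw [abs_zero] at hab
        exact h0 (by rw [abs_nonpos_iff.1 hab]; rfl)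
      have h1 := card_filter_abs_linear_le K N a b ha haK
      have h2 : F a b = 5 * K * (2 * N + Int.gcd a b) / |(a : ℝ)| := if_pos ⟨ha, hab⟩
      have := hF0 b a
      linarith
    · have hb : b ≠ 0 := by
        rintro rfl
        rw [abs_zero] at hab
        exact h0 (by rw [abs_nonpos_iff.1 hab]; rfl)
      have h1 := card_filter_abs_linear_le K N b a hb hbK
      have h2 : F b a = 5 * K * (2 * N + Int.gcd b a) / |(b : ℝ)| := if_pos ⟨hb, hab⟩
      have h3 : #{p ∈ Icc (-(K : ℤ)) K ×ˢ Icc (-(K : ℤ)) K | |a * p.1 + b * p.2| ≤ N} ≤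
          #{p ∈ Icc (-(K : ℤ)) K ×ˢ Icc (-(K : ℤ)) K | |b * p.1 + a * p.2| ≤ N} := by
        refine card_le_card_of_injOn Prod.swap ?_ (Prod.swap_injective.injOn)
        intro p hp
        have hp := mem_filter.1 (mem_coe.1 hp)
        have hq := mem_product.1 hp.1
        refine mem_coe.2 (mem_filter.2 ⟨mem_product.2 ⟨hq.2, hq.1⟩, ?_⟩)
        simpa [add_comm] using hp.2
      have h3 : ((#{p ∈ Icc (-(K : ℤ)) K ×ˢ Icc (-(K : ℤ)) K | |a * p.1 + b * p.2| ≤ N} : ℕ) : ℝ) ≤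
          ((#{p ∈ Icc (-(K : ℤ)) K ×ˢ Icc (-(K : ℤ)) K | |b * p.1 + a * p.2| ≤ N} : ℕ) : ℝ) := by
        exact_mod_cast h3
      have := hF0 a b
      linarith
  refine (sum_le_sum hT).trans ?_
  rw [sum_add_distrib, sum_add_distrib]
  have e1 : ∑ c ∈ Icc (-(K : ℤ)) K ×ˢ Icc (-(K : ℤ)) K, (if c = 0 then 9 * (K : ℝ) ^ 2 else 0) ≤
      9 * (K : ℝ) ^ 2 := by
    rw [sum_ite_eq']
    split_ifs
    · exact le_rfl
    · positivity
  have e2 : ∑ c ∈ Icc (-(K : ℤ)) K ×ˢ Icc (-(K : ℤ)) K, F c.1 c.2 ≤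
      30 * (K : ℝ) ^ 2 * (2 * N + 1 + Real.log K) := by
    rw [sum_product]
    exact sum_linear_majorant_le K N
  have e3 : ∑ c ∈ Icc (-(K : ℤ)) K ×ˢ Icc (-(K : ℤ)) K, F c.2 c.1 ≤
      30 * (K : ℝ) ^ 2 * (2 * N + 1 + Real.log K) := by
    rw [sum_product_right]
    exact sum_linear_majorant_le K N
  have hl : 0 ≤ Real.log K := Real.log_nonneg hKR
  have hK2 : (0 : ℝ) ≤ (K : ℝ) ^ 2 := by positivity
  have hN : (0 : ℝ) ≤ N := by positivity
  have := mul_nonneg hK2 hl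
  have := mul_nonneg hK2 hN
  nlinarith

open Finset in
/-- If any two members of `s` that agree off `J` form a class of size at most `m`, and each
coordinate off `J` takes at most `n` values, then `s` has at most `m * n ^ |Jᶜ|` members. -/
lemma card_le_mul_pow_of_agree {ι : Type*} [Fintype ι] [DecidableEq ι] (s : Finset (ι → ℤ))
    (J : Finset ι) (A : ι → Finset ℤ) (n m : ℕ) (hA : ∀ f ∈ s, ∀ l, f l ∈ A l)
    (hn : ∀ l, #(A l) ≤ n) (hm : ∀ f₀ ∈ s, #{f ∈ s | ∀ l, l ∉ J → f l = f₀ l} ≤ m) :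
    #s ≤ m * n ^ (Fintype.card ι - #J) := by
  have hmap : ∀ f ∈ s, (fun l : {l // l ∉ J} => f l) ∈
      Fintype.piFinset (fun l : {l // l ∉ J} => A l) := fun f hf =>
    Fintype.mem_piFinset.2 fun l => hA f hf l
  refine (card_le_mul_card_image_of_maps_to hmap m ?_).trans ?_
  · intro b _
    rcases ({f ∈ s | (fun l : {l // l ∉ J} => f l) = b}).eq_empty_or_nonempty with he | ⟨f₀, hf₀⟩
    · rw [he]; simp
    have h0 := mem_filter.1 hf₀
    refine (card_le_card fun f hf => ?_).trans (hm f₀ h0.1)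
    have h1 := mem_filter.1 hf
    exact mem_filter.2 ⟨h1.1, fun l hl => congrFun (h1.2.trans h0.2.symm) ⟨l, hl⟩⟩
  · gcongr
    rw [Fintype.card_piFinset]
    refine (prod_le_pow_card univ _ n fun l _ => hn l.1).trans (le_of_eq ?_)
    congr 1
    rw [card_univ, Fintype.card_subtype_compl]
    simp

open Finset in
lemma card_filter_dotProduct_le {ι : Type*} [Fintype ι] [DecidableEq ι] (K m : ℕ)
    (s : Finset (ι → ℤ)) (hs : ∀ f ∈ s, ∀ g ∈ s, ∀ l, |f l - g l| ≤ K) (Y : ι → ℤ)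
    (hm : ∀ f ∈ s, |f ⬝ᵥ Y| ≤ m) (j k : ι) (hjk : j ≠ k) :
    #s ≤ #{p ∈ Icc (-(K : ℤ)) K ×ˢ Icc (-(K : ℤ)) K | |Y j * p.1 + Y k * p.2| ≤ (2 * m : ℕ)} *
      (2 * K + 1) ^ (Fintype.card ι - 2) := by
  rcases s.eq_empty_or_nonempty with rfl | ⟨f₁, hf₁⟩
  · simp
  have hJ : #({j, k} : Finset ι) = 2 := card_pair hjk
  rw [show Fintype.card ι - 2 = Fintype.card ι - #({j, k} : Finset ι) by rw [hJ]]
  refine card_le_mul_pow_of_agree s {j, k} (fun l => Icc (f₁ l - K) (f₁ l + K)) _ _ ?_ ?_ ?_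
  · intro f hf l
    have := abs_le.1 (hs f hf f₁ hf₁ l)
    rw [mem_Icc]; constructor <;> linarith
  · intro l
    rw [Int.card_Icc]; omega
  · intro f₀ hf₀
    refine card_le_card_of_injOn (fun f => (f j - f₀ j, f k - f₀ k)) ?_ ?_
    · intro f hf
      obtain ⟨hf, hag⟩ := mem_filter.1 (mem_coe.1 hf)
      refine mem_coe.2 (mem_filter.2 ⟨mem_product.2 ⟨mem_Icc.2 (abs_le.1 (hs f hf f₀ hf₀ j)),
        mem_Icc.2 (abs_le.1 (hs f hf f₀ hf₀ k))⟩, ?_⟩)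
      have e : Y j * (f j - f₀ j) + Y k * (f k - f₀ k) = f ⬝ᵥ Y - f₀ ⬝ᵥ Y := by
        rw [← sub_dotProduct, dotProduct, ← sum_subset (subset_univ {j, k}), sum_pair hjk]
        · simp only [Pi.sub_apply]; ring
        · intro l _ hl
          simp [hag l hl]
      have h1 := abs_le.1 (hm f hf)
      have h2 := abs_le.1 (hm f₀ hf₀)
      simp only
      rw [e, abs_le]
      push_cast
      constructor <;> linarith
    · intro f hf g hg hfg
      have hf := (mem_filter.1 (mem_coe.1 hf)).2
      have hg := (mem_filter.1 (mem_coe.1 hg)).2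
      have h := Prod.ext_iff.1 hfg
      simp only [sub_left_inj] at h
      funext l
      by_cases hl : l ∈ ({j, k} : Finset ι)
      · rcases mem_insert.1 hl with rfl | hl
        · exact h.1
        · rw [mem_singleton.1 hl]; exact h.2
      · rw [hf l hl, hg l hl]

open Finset in
lemma card_filter_slab_le {ι : Type*} [Fintype ι] [DecidableEq ι] (K m w : ℕ) (R : ι → ℤ)
    (i j k : ι) (hij : i ≠ j) (hik : i ≠ k) (hjk : j ≠ k)
    (hw : ∀ t : ℤ, |t| ≤ (2 * K : ℕ) → |R i * t| ≤ (2 * m : ℕ) → |t| ≤ w) (s : Finset (ι → ℤ))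
    (hs : ∀ f ∈ s, ∀ l, |f l| ≤ K) (hm : ∀ f ∈ s, |R ⬝ᵥ f| ≤ m)
    (hj : ∀ f ∈ s, ∀ g ∈ s, f j = g j ∧ f k = g k) :
    #s ≤ (2 * w + 1) * (2 * K + 1) ^ (Fintype.card ι - 3) := by
  have hJ : #({i, j, k} : Finset ι) = 3 := card_eq_three.2 ⟨i, j, k, hij, hik, hjk, rfl⟩
  rw [show Fintype.card ι - 3 = Fintype.card ι - #({i, j, k} : Finset ι) by rw [hJ]]
  refine card_le_mul_pow_of_agree s {i, j, k} (fun l => Icc (-K) K) _ _ ?_ ?_ ?_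
  · intro f hf l
    exact mem_Icc.2 (abs_le.1 (hs f hf l))
  · intro l
    rw [Int.card_Icc]; omega
  · intro f₀ hf₀
    have e : #(Icc (-(w : ℤ)) w) = 2 * w + 1 := by rw [Int.card_Icc]; omega
    rw [← e]
    have hag : ∀ f ∈ ({f ∈ s | ∀ l, l ∉ ({i, j, k} : Finset ι) → f l = f₀ l}),
        f ∈ s ∧ ∀ l, l ≠ i → f l = f₀ l := by
      intro f hf
      obtain ⟨hf, h⟩ := mem_filter.1 hf
      refine ⟨hf, fun l hl => ?_⟩
      by_cases h1 : l = j
      · rw [h1]; exact (hj f hf f₀ hf₀).1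
      by_cases h2 : l = k
      · rw [h2]; exact (hj f hf f₀ hf₀).2
      exact h l (by simp [hl, h1, h2])
    refine card_le_card_of_injOn (fun f => f i - f₀ i) ?_ ?_
    · intro f hf
      obtain ⟨hf, h⟩ := hag f (mem_coe.1 hf)
      refine mem_coe.2 (mem_Icc.2 (abs_le.1 (hw _ ?_ ?_)))
      · have h1 := abs_le.1 (hs f hf i)
        have h2 := abs_le.1 (hs f₀ hf₀ i)
        push_cast
        rw [abs_le]; constructor <;> linarith
      · have e : R i * (f i - f₀ i) = R ⬝ᵥ f - R ⬝ᵥ f₀ := by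
          rw [← dotProduct_sub, dotProduct, ← sum_subset (subset_univ {i}), sum_singleton]
          · simp
          · intro l _ hl
            simp [h l (by simpa using hl)]
        have h1 := abs_le.1 (hm f hf)
        have h2 := abs_le.1 (hm f₀ hf₀)
        rw [e, abs_le]
        push_cast
        constructor <;> linarith
    · intro f hf g hg hfg
      funext l
      by_cases hl : l = i
      · rw [hl]; exact sub_left_inj.1 hfg
      · rw [(hag f hf).2 l hl, (hag g hg).2 l hl]

open Finset in
/-- Counting pairs of integer vectors, in arbitrary boxes of side `K`, whose dot product and whose
second component's `R`-component are localized. -/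
lemma card_pairs_le {ι : Type*} [Fintype ι] [DecidableEq ι] (K m w : ℕ) (hK : 1 ≤ K) (R : ι → ℤ)
    (i j k : ι) (hij : i ≠ j) (hik : i ≠ k) (hjk : j ≠ k)
    (hw : ∀ t : ℤ, |t| ≤ (2 * K : ℕ) → |R i * t| ≤ (2 * m : ℕ) → |t| ≤ w)
    (S : Finset ((ι → ℤ) × (ι → ℤ)))
    (hS : ∀ p ∈ S, ∀ q ∈ S, ∀ l, |p.1 l - q.1 l| ≤ K ∧ |p.2 l - q.2 l| ≤ K)
    (hd : ∀ p ∈ S, ∀ q ∈ S, p.1 = q.1 → |p.1 ⬝ᵥ (p.2 - q.2)| ≤ (m : ℤ) ∧ |R ⬝ᵥ (p.2 - q.2)| ≤ (m : ℤ)) :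
    ((#S : ℕ) : ℝ) ≤ (2 * K + 1) ^ (Fintype.card ι - 2) * (2 * K + 1) ^ (Fintype.card ι - 3) *
      (2 * w + 1) * (140 * (K : ℝ) ^ 2 * ((2 * m : ℕ) + 1 + Real.log K)) := by
  set I := S.image Prod.fst with hI
  set B : Finset (ι → ℤ) := {f ∈ Fintype.piFinset (fun _ : ι => Icc (-(K : ℤ)) K) | |R ⬝ᵥ f| ≤ m}
    with hB
  set T : ℤ × ℤ → ℕ := fun c =>
    #{p ∈ Icc (-(K : ℤ)) K ×ˢ Icc (-(K : ℤ)) K | |c.1 * p.1 + c.2 * p.2| ≤ (2 * m : ℕ)} with hT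
  have hex : ∀ X, ∃ Y, X ∈ I → (X, Y) ∈ S := by
    intro X
    by_cases hX : X ∈ I
    · obtain ⟨p, hp, rfl⟩ := mem_image.1 hX
      exact ⟨p.2, fun _ => hp⟩
    · exact ⟨0, fun h => absurd h hX⟩
  choose Y₀ hY₀ using hex
  have h1 : #S ≤ #{p ∈ I ×ˢ B | |p.1 ⬝ᵥ p.2| ≤ (m : ℤ)} := by
    refine card_le_card_of_injOn (fun p => (p.1, p.2 - Y₀ p.1)) ?_ ?_
    · intro p hp
      have hp := mem_coe.1 hp
      have hpI : p.1 ∈ I := mem_image_of_mem _ hp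
      have hq := hY₀ p.1 hpI
      have hpq := hd p hp _ hq rfl
      refine mem_coe.2 (mem_filter.2 ⟨mem_product.2 ⟨hpI, mem_filter.2
        ⟨Fintype.mem_piFinset.2 fun l => ?_, hpq.2⟩⟩, hpq.1⟩)
      exact mem_Icc.2 (abs_le.1 (hS p hp _ hq l).2)
    · intro p _ q _ hpq
      have h := Prod.ext_iff.1 hpq
      simp only at h
      have h2 := h.2
      rw [h.1] at h2
      exact Prod.ext h.1 (sub_left_inj.1 h2)
  have h2 : #{p ∈ I ×ˢ B | |p.1 ⬝ᵥ p.2| ≤ (m : ℤ)} = ∑ Y ∈ B, #{X ∈ I | |X ⬝ᵥ Y| ≤ (m : ℤ)} := by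
    simp only [card_filter]
    rw [sum_product_right]
  have h3 : ∀ Y ∈ B, #{X ∈ I | |X ⬝ᵥ Y| ≤ (m : ℤ)} ≤
      T (Y j, Y k) * (2 * K + 1) ^ (Fintype.card ι - 2) := by
    intro Y _
    refine card_filter_dotProduct_le K m _ ?_ Y (fun f hf => (mem_filter.1 hf).2) j k hjk
    intro f hf g hg l
    obtain ⟨p, hp, rfl⟩ := mem_image.1 (mem_filter.1 hf).1
    obtain ⟨q, hq, rfl⟩ := mem_image.1 (mem_filter.1 hg).1
    exact (hS p hp q hq l).1
  have hmap : ∀ Y ∈ B, (Y j, Y k) ∈ Icc (-(K : ℤ)) K ×ˢ Icc (-(K : ℤ)) K := by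
    intro Y hY
    have := Fintype.mem_piFinset.1 (mem_filter.1 hY).1
    exact mem_product.2 ⟨this j, this k⟩
  have h4 : ∑ Y ∈ B, T (Y j, Y k) ≤ ∑ c ∈ Icc (-(K : ℤ)) K ×ˢ Icc (-(K : ℤ)) K,
      (2 * w + 1) * (2 * K + 1) ^ (Fintype.card ι - 3) * T c := by
    rw [← sum_fiberwise_of_maps_to hmap]
    refine sum_le_sum fun c _ => ?_
    rw [sum_congr rfl (g := fun _ => T c) (fun Y hY => by rw [(mem_filter.1 hY).2]), sum_const,
      smul_eq_mul]
    gcongr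
    refine card_filter_slab_le K m w R i j k hij hik hjk hw _ ?_ ?_ ?_
    · intro f hf l
      have := Fintype.mem_piFinset.1 (mem_filter.1 (mem_filter.1 hf).1).1 l
      exact abs_le.2 (mem_Icc.1 this)
    · intro f hf
      exact (mem_filter.1 (mem_filter.1 hf).1).2
    · intro f hf g hg
      have := (mem_filter.1 hf).2.trans (mem_filter.1 hg).2.symm
      exact Prod.ext_iff.1 this
  have h5 := sum_card_filter_abs_linear_le K (2 * m) hK
  have h6 : #S ≤ ((2 * w + 1) * (2 * K + 1) ^ (Fintype.card ι - 3) *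
      ∑ c ∈ Icc (-(K : ℤ)) K ×ˢ Icc (-(K : ℤ)) K, T c) * (2 * K + 1) ^ (Fintype.card ι - 2) := by
    rw [mul_sum]
    refine (h1.trans_eq h2).trans ((sum_le_sum h3).trans ?_)
    rw [← sum_mul]
    gcongr
  have h7 : ((#S : ℕ) : ℝ) ≤ ((2 * w + 1) * (2 * K + 1) ^ (Fintype.card ι - 3) *
      ∑ c ∈ Icc (-(K : ℤ)) K ×ˢ Icc (-(K : ℤ)) K, (T c : ℝ)) *
      (2 * K + 1) ^ (Fintype.card ι - 2) := by
    exact_mod_cast h6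
  refine h7.trans ?_
  calc _ ≤ ((2 * w + 1) * (2 * K + 1) ^ (Fintype.card ι - 3) *
      (140 * (K : ℝ) ^ 2 * ((2 * m : ℕ) + 1 + Real.log K))) *
      (2 * K + 1) ^ (Fintype.card ι - 2) := by gcongr
    _ = _ := by ring

/-- The lattice point of `ℤ_L^d` with integer coordinates `X`. -/
def latticePoint {d : ℕ} (L : ℝ) (X : Fin d → ℤ) : EuclideanSpace ℝ (Fin d) :=
  WithLp.toLp 2 fun i => (X i : ℝ) / L

lemma exists_latticePoint_eq {d : ℕ} {L : ℝ} {x : EuclideanSpace ℝ (Fin d)} (hx : x ∈ ZLat d L) :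
    ∃ X, latticePoint L X = x := by
  choose X hX using hx
  exact ⟨X, by ext i; simp [latticePoint, hX]⟩

lemma inner_latticePoint {d : ℕ} {L : ℝ} (hL : L ≠ 0) (X Y : Fin d → ℤ) :
    ((X ⬝ᵥ Y : ℤ) : ℝ) = L ^ 2 * ⟪latticePoint L X, latticePoint L Y⟫ := by
  simp only [latticePoint, dotProduct, PiLp.inner_apply, Int.cast_sum, Int.cast_mul, Finset.mul_sum]
  refine Finset.sum_congr rfl fun i _ => ?_
  simp
  field_simp

lemma abs_sub_le_mul_norm_latticePoint {d : ℕ} {L : ℝ} (hL : 0 < L) (X : Fin d → ℤ)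
    (x : EuclideanSpace ℝ (Fin d)) (l : Fin d) :
    |(X l : ℝ) - L * x l| ≤ L * ‖latticePoint L X - x‖ := by
  have h := PiLp.norm_apply_le (latticePoint L X - x) l
  have e : (X l : ℝ) - L * x l = L * (latticePoint L X - x) l := by
    simp [latticePoint]
    field_simp
  rw [e, abs_mul, abs_of_pos hL]
  gcongr
  exact h

lemma finite_setOf_latticePoint_mem {d : ℕ} {L : ℝ} (hL : 0 < L) (x : EuclideanSpace ℝ (Fin d)) :
    {X : Fin d → ℤ | ‖latticePoint L X - x‖ ≤ 1}.Finite := by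
  refine (Set.finite_Icc (fun l => ⌈L * x l - L⌉) (fun l => ⌊L * x l + L⌋)).subset ?_
  intro X hX
  have h : ∀ l, |(X l : ℝ) - L * x l| ≤ L := fun l =>
    (abs_sub_le_mul_norm_latticePoint hL X x l).trans (by
      have : ‖latticePoint L X - x‖ ≤ 1 := hX
      nlinarith)
  refine ⟨fun l => Int.ceil_le.2 ?_, fun l => Int.le_floor.2 ?_⟩
  · have := (abs_le.1 (h l)).1; linarith
  · have := (abs_le.1 (h l)).2; linarith

lemma exists_finset_count1_le {d : ℕ} {L : ℝ} (hL : 0 < L) (δ γ α β : ℝ)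
    (r x0 y0 : EuclideanSpace ℝ (Fin d))
    (ξ : EuclideanSpace ℝ (Fin d) → EuclideanSpace ℝ (Fin d) → EuclideanSpace ℝ (Fin d)) :
    ∃ S : Finset ((Fin d → ℤ) × (Fin d → ℤ)), count1 d L δ γ α β r x0 y0 ξ ≤ S.card ∧
      ∀ p ∈ S, ‖latticePoint L p.1 - x0‖ ≤ 1 ∧ ‖latticePoint L p.2 - y0‖ ≤ 1 ∧
        |⟪latticePoint L p.1, latticePoint L p.2⟫ - α| ≤ δ⁻¹ * L ^ (-(2 * γ)) ∧
        |⟪r, ξ (latticePoint L p.1) (latticePoint L p.2)⟫ - β| ≤ δ⁻¹ * L ^ (-(2 * γ)) := by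
  set A : Set ((Fin d → ℤ) × (Fin d → ℤ)) := {p | ‖latticePoint L p.1 - x0‖ ≤ 1 ∧
    ‖latticePoint L p.2 - y0‖ ≤ 1 ∧
    |⟪latticePoint L p.1, latticePoint L p.2⟫ - α| ≤ δ⁻¹ * L ^ (-(2 * γ)) ∧
    |⟪r, ξ (latticePoint L p.1) (latticePoint L p.2)⟫ - β| ≤ δ⁻¹ * L ^ (-(2 * γ))}
  have hA : A.Finite :=
    ((finite_setOf_latticePoint_mem hL x0).prod (finite_setOf_latticePoint_mem hL y0)).subset
      fun p hp => ⟨hp.1, hp.2.1⟩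
  refine ⟨hA.toFinset, ?_, fun p hp => hA.mem_toFinset.1 hp⟩
  rw [← Set.ncard_eq_toFinset_card A hA]
  refine le_trans (Set.ncard_le_ncard (t := (Prod.map (latticePoint L) (latticePoint L)) '' A)
    ?_ (hA.image _)) (Set.ncard_image_le hA)
  rintro ⟨x, y⟩ ⟨hx, hy, h⟩
  obtain ⟨X, rfl⟩ := exists_latticePoint_eq hx
  obtain ⟨Y, rfl⟩ := exists_latticePoint_eq hy
  exact ⟨(X, Y), h, rfl⟩

lemma abs_dotProduct_sub_le {d : ℕ} {L : ℝ} (hL : 0 < L) (Z X Y : Fin d → ℤ) (ε : ℝ)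
    (h : |⟪latticePoint L Z, latticePoint L X⟫ - ⟪latticePoint L Z, latticePoint L Y⟫| ≤ 2 * ε) :
    |Z ⬝ᵥ (X - Y)| ≤ (⌊2 * (ε * L ^ 2)⌋₊ : ℤ) := by
  have h1 : ((|Z ⬝ᵥ (X - Y)| : ℤ) : ℝ) ≤ 2 * (ε * L ^ 2) := by
    rw [dotProduct_sub, Int.cast_abs, Int.cast_sub, inner_latticePoint hL.ne',
      inner_latticePoint hL.ne', ← mul_sub, abs_mul, abs_of_pos (by positivity)]
    nlinarith [sq_nonneg L]
  rw [Int.abs_eq_natAbs, Int.cast_natCast] at h1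
  rw [Int.abs_eq_natAbs]
  exact_mod_cast Nat.le_floor h1

lemma abs_sub_le_floor {d : ℕ} {L : ℝ} (hL : 0 < L) (X Y : Fin d → ℤ)
    (x : EuclideanSpace ℝ (Fin d)) (hX : ‖latticePoint L X - x‖ ≤ 1)
    (hY : ‖latticePoint L Y - x‖ ≤ 1) (l : Fin d) : |X l - Y l| ≤ (⌊2 * L⌋₊ : ℤ) := by
  have h1 := (abs_sub_le_mul_norm_latticePoint hL X x l).trans (mul_le_of_le_one_right hL.le hX)
  have h2 := (abs_sub_le_mul_norm_latticePoint hL Y x l).trans (mul_le_of_le_one_right hL.le hY)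
  have h3 : ((|X l - Y l| : ℤ) : ℝ) ≤ 2 * L := by
    rw [Int.cast_abs, Int.cast_sub, abs_le]
    have h1 := abs_le.1 h1
    have h2 := abs_le.1 h2
    constructor <;> linarith
  rw [Int.abs_eq_natAbs, Int.cast_natCast] at h3
  rw [Int.abs_eq_natAbs]
  exact_mod_cast Nat.le_floor h3

lemma abs_sub_le_two_mul {a b c ε : ℝ} (ha : |a - c| ≤ ε) (hb : |b - c| ≤ ε) :
    |a - b| ≤ 2 * ε := by
  rw [abs_le] at *
  constructor <;> linarith [ha.1, ha.2, hb.1, hb.2]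

lemma count1_le_of_width {d : ℕ} {L : ℝ} (hL : 1 ≤ L) (δ γ α β : ℝ) (R : Fin d → ℤ)
    (x0 y0 : EuclideanSpace ℝ (Fin d))
    (ξ : EuclideanSpace ℝ (Fin d) → EuclideanSpace ℝ (Fin d) → EuclideanSpace ℝ (Fin d))
    (hξ : (∀ x y, ξ x y = x) ∨ (∀ x y, ξ x y = y) ∨ (∀ x y, ξ x y = x + y))
    (K m w : ℕ) (hK : K = ⌊2 * L⌋₊) (hm : m = ⌊2 * (δ⁻¹ * L ^ (-(2 * γ)) * L ^ 2)⌋₊)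
    (i j k : Fin d) (hij : i ≠ j) (hik : i ≠ k) (hjk : j ≠ k)
    (hw : ∀ t : ℤ, |t| ≤ (2 * K : ℕ) → |R i * t| ≤ (2 * m : ℕ) → |t| ≤ w) :
    (count1 d L δ γ α β (latticePoint L R) x0 y0 ξ : ℝ) ≤
      (2 * K + 1) ^ (d - 2) * (2 * K + 1) ^ (d - 3) *
      (2 * w + 1) * (140 * (K : ℝ) ^ 2 * ((2 * m : ℕ) + 1 + Real.log K)) := by
  have hL0 : 0 < L := by linarith
  have hK1 : 1 ≤ K := by rw [hK]; exact Nat.le_floor (by push_cast; linarith)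
  obtain ⟨S, hcount, hS⟩ := exists_finset_count1_le hL0 δ γ α β (latticePoint L R) x0 y0 ξ
  have hbox : ∀ p ∈ S, ∀ q ∈ S, ∀ l, |p.1 l - q.1 l| ≤ K ∧ |p.2 l - q.2 l| ≤ K := by
    intro p hp q hq l
    rw [hK]
    exact ⟨abs_sub_le_floor hL0 _ _ x0 (hS p hp).1 (hS q hq).1 l,
      abs_sub_le_floor hL0 _ _ y0 (hS p hp).2.1 (hS q hq).2.1 l⟩
  refine le_trans (Nat.cast_le.2 hcount) ?_
  by_cases hx : ∀ x y, ξ x y = x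
  · have key := card_pairs_le K m w hK1 R i j k hij hik hjk hw (S.map (Equiv.prodComm _ _).toEmbedding)
      ?_ ?_
    · rwa [Finset.card_map, Fintype.card_fin] at key
    · simp only [Finset.mem_map_equiv]
      intro p hp q hq l
      exact (hbox _ hp _ hq l).symm
    · simp only [Finset.mem_map_equiv]
      rintro ⟨p1, p2⟩ hp ⟨q1, q2⟩ hq hpq
      have h1 := (hS _ hp).2.2
      have h2 := (hS _ hq).2.2
      simp only [hx, Equiv.prodComm_symm, Equiv.prodComm_apply, Prod.swap_prod_mk] at h1 h2 hpq
      subst hpq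
      rw [hm]
      refine ⟨abs_dotProduct_sub_le hL0 _ _ _ _ ?_, abs_dotProduct_sub_le hL0 _ _ _ _ ?_⟩
      · rw [real_inner_comm, real_inner_comm (latticePoint L q2)]
        exact abs_sub_le_two_mul h1.1 h2.1
      · exact abs_sub_le_two_mul h1.2 h2.2
  · have hξ' := hξ.resolve_left hx
    have key := card_pairs_le K m w hK1 R i j k hij hik hjk hw S hbox ?_
    · rwa [Fintype.card_fin] at key
    · rintro ⟨p1, p2⟩ hp ⟨q1, q2⟩ hq hpq
      have h1 := (hS _ hp).2.2
      have h2 := (hS _ hq).2.2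
      simp only at h1 h2 hpq
      subst hpq
      rw [hm]
      refine ⟨abs_dotProduct_sub_le hL0 _ _ _ _ (abs_sub_le_two_mul h1.1 h2.1),
        abs_dotProduct_sub_le hL0 _ _ _ _ ?_⟩
      have h3 := abs_sub_le_two_mul h1.2 h2.2
      rcases hξ' with h | h
      · simpa only [h] using h3
      · simpa only [h, inner_add_right, add_sub_add_left_eq_sub] using h3

open Finset in
lemma exists_coord_norm_le {d : ℕ} (hd : 3 ≤ d) (r : EuclideanSpace ℝ (Fin d)) :
    ∃ i j k : Fin d, i ≠ j ∧ i ≠ k ∧ j ≠ k ∧ ‖r‖ ≤ d * |r i| := by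
  have : Nonempty (Fin d) := ⟨⟨0, by omega⟩⟩
  obtain ⟨i, -, hi⟩ := exists_max_image univ (fun l => |r l|) univ_nonempty
  have hc : 1 < #(univ.erase i) := by
    rw [card_erase_of_mem (mem_univ i), card_univ, Fintype.card_fin]; omega
  obtain ⟨j, hj, k, hk, hjk⟩ := one_lt_card.1 hc
  refine ⟨i, j, k, (ne_of_mem_erase hj).symm, (ne_of_mem_erase hk).symm, hjk, ?_⟩
  have hd1 : (1 : ℝ) ≤ d := by exact_mod_cast (by omega : 1 ≤ d)
  rw [EuclideanSpace.norm_eq]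
  refine Real.sqrt_le_iff.2 ⟨by positivity, ?_⟩
  have h1 : ∑ l, ‖r l‖ ^ 2 ≤ ∑ _l : Fin d, |r i| ^ 2 := by
    refine sum_le_sum fun l _ => ?_
    rw [Real.norm_eq_abs]
    exact pow_le_pow_left₀ (abs_nonneg _) (hi l (mem_univ l)) 2
  rw [sum_const, card_univ, Fintype.card_fin, nsmul_eq_mul] at h1
  refine h1.trans ?_
  rw [mul_pow]
  gcongr
  nlinarith

/-- The basic bound: up to constants, the count is at most `δ⁻¹ L^{2(d-γ)}` times the proportion
`L⁻¹ + δ⁻¹ L^{-2γ} / P` of admissible values of one coordinate. -/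
lemma exists_count1_le (d : ℕ) (hd : 3 ≤ d) (γ : ℝ) (hγ' : γ < 1) :
    ∃ C : ℝ, 1 ≤ C ∧ ∀ L δ : ℝ, 2 ≤ L → 0 < δ → δ < 1 →
    ∀ (α β : ℝ) (r : EuclideanSpace ℝ (Fin d)), r ∈ ZLat d L →
    ∀ (x0 y0 : EuclideanSpace ℝ (Fin d))
      (ξ : EuclideanSpace ℝ (Fin d) → EuclideanSpace ℝ (Fin d) → EuclideanSpace ℝ (Fin d)),
      ((∀ x y, ξ x y = x) ∨ (∀ x y, ξ x y = y) ∨ (∀ x y, ξ x y = x + y)) →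
      (count1 d L δ γ α β r x0 y0 ξ : ℝ) ≤ C * (δ⁻¹ * L ^ (2 * ((d : ℝ) - γ))) ∧
      ∀ P : ℝ, 0 < P → P ≤ ‖r‖ → (count1 d L δ γ α β r x0 y0 ξ : ℝ) ≤
        C * (δ⁻¹ * L ^ (2 * ((d : ℝ) - γ))) * (L⁻¹ + δ⁻¹ * L ^ (-(2 * γ)) / P) := by
  set s : ℝ := 2 - 2 * γ with hs
  have hs0 : 0 < s := by linarith
  set D : ℝ := 6 ^ (2 * d - 5) * 560 * (5 + (2 : ℝ) ^ s / s) with hD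
  have hdR : (3 : ℝ) ≤ d := by exact_mod_cast hd
  have hD1 : 1 ≤ D := by
    have h1 : (1 : ℝ) ≤ 6 ^ (2 * d - 5) := one_le_pow₀ (by norm_num)
    have h2 : (1 : ℝ) ≤ 5 + (2 : ℝ) ^ s / s := by
      have : 0 < (2 : ℝ) ^ s / s := by positivity
      linarith
    nlinarith
  refine ⟨D * (10 * d), by nlinarith, ?_⟩
  intro L δ hL hδ hδ' α β r hr x0 y0 ξ hξ
  have hL0 : 0 < L := by linarith
  have hδ1 : 1 ≤ δ⁻¹ := (one_le_inv₀ hδ).2 hδ'.le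
  obtain ⟨R, rfl⟩ := exists_latticePoint_eq hr
  obtain ⟨i, j, k, hij, hik, hjk, hi⟩ := exists_coord_norm_le hd (latticePoint L R)
  set ε : ℝ := δ⁻¹ * L ^ (-(2 * γ)) with hε
  set M : ℝ := ε * L ^ 2 with hM
  set K : ℕ := ⌊2 * L⌋₊ with hK
  set m : ℕ := ⌊2 * M⌋₊ with hm
  have hMs : M = δ⁻¹ * L ^ s := by
    rw [hM, hε, mul_assoc, ← Real.rpow_natCast L 2, ← Real.rpow_add hL0]
    congr 2
    rw [hs]; push_cast; ring
  have hLs : 1 ≤ L ^ s := Real.one_le_rpow (by linarith) hs0.le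
  have hMLs : L ^ s ≤ M := by rw [hMs]; nlinarith
  have hM1 : 1 ≤ M := hLs.trans hMLs
  have hKle : (K : ℝ) ≤ 2 * L := Nat.floor_le (by positivity)
  have hK1 : 1 ≤ K := Nat.le_floor (by push_cast; linarith)
  have hK1R : (1 : ℝ) ≤ K := by exact_mod_cast hK1
  have hmle : (m : ℝ) ≤ 2 * M := Nat.floor_le (by positivity)
  have hlog : Real.log K ≤ (2 : ℝ) ^ s / s * M := by
    have h1 := Real.log_le_rpow_div (x := (K : ℝ)) (by positivity) hs0
    refine h1.trans ?_
    rw [div_mul_eq_mul_div]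
    gcongr
    calc (K : ℝ) ^ s ≤ (2 * L) ^ s := Real.rpow_le_rpow (by positivity) hKle hs0.le
      _ = 2 ^ s * L ^ s := Real.mul_rpow (by norm_num) hL0.le
      _ ≤ _ := by gcongr
  have hG : M * L ^ (2 * d - 3) * L = δ⁻¹ * L ^ (2 * ((d : ℝ) - γ)) := by
    rw [hMs, mul_assoc, mul_assoc, ← pow_succ, ← Real.rpow_natCast, ← Real.rpow_add hL0]
    congr 2
    rw [show 2 * d - 3 + 1 = 2 * d - 2 by omega, Nat.cast_sub (by omega), hs]
    push_cast; ring
  have main : ∀ w : ℕ, (∀ t : ℤ, |t| ≤ (2 * K : ℕ) → |R i * t| ≤ (2 * m : ℕ) → |t| ≤ w) →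
      (count1 d L δ γ α β (latticePoint L R) x0 y0 ξ : ℝ) ≤
        D * (M * L ^ (2 * d - 3)) * (2 * w + 1) := by
    intro w hw
    refine (count1_le_of_width (by linarith) δ γ α β R x0 y0 ξ hξ K m w hK hm i j k hij hik hjk
      hw).trans ?_
    have hl0 : 0 ≤ Real.log K := Real.log_nonneg hK1R
    calc _ ≤ (6 * L) ^ (d - 2) * (6 * L) ^ (d - 3) * (2 * w + 1) *
          (140 * (2 * L) ^ 2 * ((5 + (2 : ℝ) ^ s / s) * M)) := by
          have h6 : 2 * (K : ℝ) + 1 ≤ 6 * L := by linarith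
          have h7 : ((2 * m : ℕ) : ℝ) + 1 + Real.log K ≤ (5 + (2 : ℝ) ^ s / s) * M := by
            push_cast; linarith
          gcongr
      _ = _ := by
          rw [← pow_add, show d - 2 + (d - 3) = 2 * d - 5 by omega, mul_pow,
            show 2 * d - 3 = 2 * d - 5 + 2 by omega, pow_add, hD]
          ring
  have hG0 : 0 ≤ M * L ^ (2 * d - 3) := by positivity
  constructor
  · refine (main (2 * K) fun t h _ => by exact_mod_cast h).trans ?_
    rw [← hG]
    calc _ ≤ D * (M * L ^ (2 * d - 3)) * (10 * d * L) := by
          gcongr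
          push_cast
          nlinarith
      _ = _ := by ring
  · intro P hP hPr
    have hRi : L * P ≤ d * |(R i : ℝ)| := by
      have e : |(latticePoint L R) i| = |(R i : ℝ)| / L := by
        simp [latticePoint, abs_div, abs_of_pos hL0]
      rw [e] at hi
      have := hPr.trans hi
      rw [← mul_div_assoc, le_div_iff₀ hL0] at this
      linarith
    have hLP : 0 < L * P := by positivity
    have hRpos : 0 < |(R i : ℝ)| := by
      by_contra h
      have : |(R i : ℝ)| = 0 := le_antisymm (not_lt.1 h) (abs_nonneg _)
      rw [this] at hRi
      linarith
    have hRne : R i ≠ 0 := by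
      rintro h
      simp [h] at hRpos
    have hRn : 0 < (R i).natAbs := Int.natAbs_pos.2 hRne
    have hcast : |(R i : ℝ)| = ((R i).natAbs : ℝ) := by rw [Nat.cast_natAbs]; simp
    refine (main (2 * m / (R i).natAbs) ?_).trans ?_
    · intro t _ h
      rw [Int.abs_eq_natAbs, Int.natAbs_mul] at h
      rw [Int.abs_eq_natAbs]
      have h : (R i).natAbs * t.natAbs ≤ 2 * m := by exact_mod_cast h
      exact_mod_cast (Nat.le_div_iff_mul_le hRn).2 (by linarith)
    · have h1 : ((2 * m / (R i).natAbs : ℕ) : ℝ) ≤ 4 * d * (M / (L * P)) := by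
        refine Nat.cast_div_le.trans ?_
        rw [← hcast, div_le_iff₀ hRpos]
        push_cast
        have h2 : M ≤ M / (L * P) * (d * |(R i : ℝ)|) := by
          calc M = M / (L * P) * (L * P) := by field_simp
            _ ≤ _ := by gcongr
        nlinarith
      rw [← hG]
      have hMP : 0 ≤ M / (L * P) := by positivity
      calc _ ≤ D * (M * L ^ (2 * d - 3)) * (10 * d * (1 + M / (L * P))) := by
            gcongr
            nlinarith
        _ = _ := by
            rw [hM]
            field_simp

/-- Trading the two-term factor for `(1 + P / ε)⁻¹` when `L⁻¹ ≤ ε`. -/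
lemma le_mul_inv_one_add_div {N M L ε P : ℝ} (hM : 0 ≤ M) (hε : 0 < ε) (hP : P ≤ 1)
    (hP0 : 0 ≤ P) (hLε : L⁻¹ ≤ ε ∨ P = 0) (h0 : N ≤ M)
    (h1 : 0 < P → N ≤ M * (L⁻¹ + ε / P)) :
    N ≤ 4 * M * (1 + P / ε)⁻¹ := by
  by_cases hPε : P ≤ ε
  · have h2 : (1 / 2 : ℝ) ≤ (1 + P / ε)⁻¹ := by
      rw [one_div]
      have : P / ε ≤ 1 := (div_le_one hε).2 hPε
      gcongr
      linarith
    calc N ≤ 4 * M * (1 / 2) := by linarith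
      _ ≤ 4 * M * (1 + P / ε)⁻¹ := by gcongr
  · have hPpos : 0 < P := hε.trans (not_le.1 hPε)
    have hLε' : L⁻¹ ≤ ε := hLε.resolve_right hPpos.ne'
    have h2 : ε ≤ ε / P := le_div_self hε.le hPpos hP
    have h3 : ε / (2 * P) ≤ (1 + P / ε)⁻¹ := by
      rw [← inv_div]
      have : 1 ≤ P / ε := (one_le_div hε).2 (not_le.1 hPε).le
      gcongr
      rw [mul_div_assoc]
      linarith
    calc N ≤ M * (L⁻¹ + ε / P) := h1 hPpos
      _ ≤ M * (2 * (ε / P)) := by gcongr; linarith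
      _ = 4 * M * (ε / (2 * P)) := by field_simp; ring
      _ ≤ 4 * M * (1 + P / ε)⁻¹ := by gcongr

lemma inv_add_div_le_min {L δ γ η P : ℝ} (hL : 1 ≤ L) (hδ : 1 ≤ δ⁻¹) (hγ : 1 / 2 < γ)
    (hγ' : γ < 1) (hη : 10 * η ≤ 2 * γ - 1) (hP : 0 < P) (hLP : 1 ≤ L * P) :
    L⁻¹ + δ⁻¹ * L ^ (-(2 * γ)) / P ≤ 2 * δ⁻¹ *
      min ((L * P)⁻¹ + L ^ (-(2 - 2 * γ))) (L ^ (-(10 * η))) := by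
  have hL0 : 0 < L := by linarith
  have hδ0 : 0 < δ⁻¹ := by linarith
  have hεP : δ⁻¹ * L ^ (-(2 * γ)) / P = δ⁻¹ * (L ^ (1 - 2 * γ) * (L * P)⁻¹) := by
    rw [sub_eq_add_neg, Real.rpow_add hL0, Real.rpow_one]
    field_simp
  have hinv : (L * P)⁻¹ ≤ 1 := inv_le_one_of_one_le₀ hLP
  have hinv0 : 0 < (L * P)⁻¹ := by positivity
  have hpow : ∀ a b : ℝ, a ≤ b → L ^ a ≤ L ^ b := fun a b h =>
    Real.rpow_le_rpow_of_exponent_le hL h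
  rw [hεP, ← Real.rpow_neg_one, mul_min_of_nonneg _ _ (by positivity), le_min_iff]
  constructor
  · have h1 := hpow (-1) (-(2 - 2 * γ)) (by linarith)
    have h2 : L ^ (1 - 2 * γ) ≤ 1 :=
      Real.rpow_le_one_of_one_le_of_nonpos hL (by linarith)
    have h3 : L ^ (1 - 2 * γ) * (L * P)⁻¹ ≤ (L * P)⁻¹ := mul_le_of_le_one_left hinv0.le h2
    have h4 : 0 < L ^ (-(2 - 2 * γ)) := by positivity
    have h5 := mul_pos hδ0 h4
    have h6 := mul_pos hδ0 hinv0
    calc L ^ (-1 : ℝ) + δ⁻¹ * (L ^ (1 - 2 * γ) * (L * P)⁻¹)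
        ≤ δ⁻¹ * L ^ (-(2 - 2 * γ)) + δ⁻¹ * (L * P)⁻¹ :=
          add_le_add (h1.trans (le_mul_of_one_le_left h4.le hδ))
            (mul_le_mul_of_nonneg_left h3 hδ0.le)
      _ ≤ 2 * (δ⁻¹ * (L * P)⁻¹ + δ⁻¹ * L ^ (-(2 - 2 * γ))) := by linarith
      _ = _ := by ring
  · have h1 := hpow (-1) (-(10 * η)) (by linarith)
    have h2 := hpow (1 - 2 * γ) (-(10 * η)) (by linarith)
    have h4 : 0 < L ^ (-(10 * η)) := by positivity
    have h3 : L ^ (1 - 2 * γ) * (L * P)⁻¹ ≤ L ^ (-(10 * η)) :=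
      (mul_le_of_le_one_right (by positivity) hinv).trans h2
    calc L ^ (-1 : ℝ) + δ⁻¹ * (L ^ (1 - 2 * γ) * (L * P)⁻¹)
        ≤ δ⁻¹ * L ^ (-(10 * η)) + δ⁻¹ * L ^ (-(10 * η)) :=
          add_le_add (h1.trans (le_mul_of_one_le_left h4.le hδ))
            (mul_le_mul_of_nonneg_left h3 hδ0.le)
      _ = _ := by ring

/-- A small power of `L` absorbs both `δ⁻¹` and a squared logarithm. -/
lemma inv_mul_rpow_le_inv_log_sq {L δ η : ℝ} (hL : 1 < L) (hη : 0 < η) (hη1 : η ≤ 1)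
    (hδL : δ⁻¹ ≤ L ^ (η ^ 2)) :
    δ⁻¹ * L ^ (-(10 * η)) ≤ (η ^ 2)⁻¹ * (Real.log L ^ 2)⁻¹ := by
  have hL0 : 0 < L := by linarith
  have hlog : 0 < Real.log L := Real.log_pos hL
  have hlogη : Real.log L ^ 2 ≤ (η ^ 2)⁻¹ * L ^ (2 * η) := by
    have h1 := Real.log_le_rpow_div hL0.le hη
    calc Real.log L ^ 2 ≤ (L ^ η / η) ^ 2 := by gcongr
      _ = _ := by
        rw [div_pow, ← Real.rpow_mul_natCast hL0.le, mul_comm η]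
        push_cast
        field_simp
  rw [← div_eq_mul_inv, le_div_iff₀ (by positivity)]
  calc δ⁻¹ * L ^ (-(10 * η)) * Real.log L ^ 2
      ≤ L ^ (η ^ 2) * L ^ (-(10 * η)) * ((η ^ 2)⁻¹ * L ^ (2 * η)) := by gcongr
    _ = (η ^ 2)⁻¹ * L ^ (η ^ 2 + -(10 * η) + 2 * η) := by
        rw [Real.rpow_add hL0, Real.rpow_add hL0]; ring
    _ ≤ (η ^ 2)⁻¹ * 1 := by
        gcongr
        exact Real.rpow_le_one_of_one_le_of_nonpos hL.le (by nlinarith)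
    _ = _ := mul_one _

theorem statement2 (d : ℕ) (hd : 3 ≤ d) (γ : ℝ) (hγ : 0 < γ) (hγ' : γ < 1) :
    ∃ η₀ : ℝ, 0 < η₀ ∧ ∀ η : ℝ, 0 < η → η ≤ η₀ →
    ∃ C : ℝ, 2 ≤ C ∧
    ∀ L δ : ℝ, C ≤ L → 0 < δ → δ < 1 → δ⁻¹ ≤ L ^ (η ^ 2) →
    ∀ (α β : ℝ) (r : EuclideanSpace ℝ (Fin d)), r ∈ ZLat d L →
    ∀ P : ℝ,
      ((P = 0 ∧ r = 0) ∨ (L⁻¹ ≤ P ∧ P < 1 ∧ P ≤ ‖r‖ ∧ ‖r‖ ≤ 2 * P) ∨ (P = 1 ∧ 1 ≤ ‖r‖)) →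
    ∀ (x0 y0 : EuclideanSpace ℝ (Fin d))
      (ξ : EuclideanSpace ℝ (Fin d) → EuclideanSpace ℝ (Fin d) → EuclideanSpace ℝ (Fin d)),
      ((∀ x y, ξ x y = x) ∨ (∀ x y, ξ x y = y) ∨ (∀ x y, ξ x y = x + y)) →
      ((γ ≤ 1 / 2 ∨ P = 0 →
          (count1 d L δ γ α β r x0 y0 ξ : ℝ) ≤
            C * δ⁻¹ * L ^ (2 * ((d : ℝ) - γ)) * (1 + δ * L ^ (2 * γ) * P)⁻¹) ∧
        (1 / 2 < γ ∧ P ≠ 0 →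
          (count1 d L δ γ α β r x0 y0 ξ : ℝ) ≤
            C * δ⁻¹ ^ 2 * L ^ (2 * ((d : ℝ) - γ)) *
              min ((L * P)⁻¹ + L ^ (-(2 - 2 * γ))) (L ^ (-(10 * η)))) ∧
        (count1 d L δ γ α β r x0 y0 ξ : ℝ) ≤
          C * δ⁻¹ * L ^ (2 * ((d : ℝ) - γ)) *
            (min (Real.log L ^ 2) (1 + δ * L ^ (2 * γ) * P))⁻¹) := by
  obtain ⟨D, hD1, hD⟩ := exists_count1_le d hd γ hγ'
  refine ⟨if γ ≤ 1 / 2 then 1 / 10 else (2 * γ - 1) / 10, ?_, ?_⟩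
  · split_ifs with h
    · norm_num
    · linarith
  intro η hη hη₀
  have hη1 : η ≤ 1 / 10 := hη₀.trans (by split_ifs <;> linarith)
  refine ⟨4 * D * (1 + (η ^ 2)⁻¹), ?_, ?_⟩
  · have : 0 < (η ^ 2)⁻¹ := by positivity
    nlinarith
  intro L δ hCL hδ hδ' hδL α β r hr P hP x0 y0 ξ hξ
  have hηi : 0 < (η ^ 2)⁻¹ := by positivity
  set C := 4 * D * (1 + (η ^ 2)⁻¹) with hC
  have hCD : 4 * D ≤ C := by rw [hC]; nlinarith
  have hL : 2 ≤ L := by nlinarith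
  have hL0 : 0 < L := by linarith
  have hlog : 0 < Real.log L := Real.log_pos (by linarith)
  have hδ1 : 1 ≤ δ⁻¹ := (one_le_inv₀ hδ).2 hδ'.le
  have hδ0 : 0 < δ⁻¹ := inv_pos.2 hδ
  have hD0 : 0 < D := by linarith
  obtain ⟨b0, b1⟩ := hD L δ hL hδ hδ' α β r hr x0 y0 ξ hξ
  set N : ℝ := (count1 d L δ γ α β r x0 y0 ξ : ℝ) with hN
  set V : ℝ := L ^ (2 * ((d : ℝ) - γ)) with hV
  have hV0 : 0 < V := by positivity
  have hP0 : 0 ≤ P := by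
    rcases hP with ⟨h, -⟩ | ⟨h, -⟩ | ⟨h, -⟩
    · exact h.ge
    · exact le_trans (by positivity) h
    · rw [h]; norm_num
  have hP1 : P ≤ 1 := by
    rcases hP with ⟨h, -⟩ | ⟨-, h, -⟩ | ⟨h, -⟩
    · rw [h]; norm_num
    · exact h.le
    · exact h.le
  have hPr : P ≤ ‖r‖ := by
    rcases hP with ⟨h, -⟩ | ⟨-, -, h, -⟩ | ⟨h, h'⟩
    · rw [h]; exact norm_nonneg _
    · exact h
    · rwa [h]
  have hPL : P ≠ 0 → 1 ≤ L * P := by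
    intro h0
    rcases hP with ⟨h, -⟩ | ⟨h, -⟩ | ⟨h, -⟩
    · exact absurd h h0
    · rwa [← inv_mul_le_iff₀ hL0, mul_one]
    · rw [h]; linarith
  set ε : ℝ := δ⁻¹ * L ^ (-(2 * γ)) with hε
  have hε0 : 0 < ε := by positivity
  have hεP : δ * L ^ (2 * γ) * P = P / ε := by
    rw [hε, Real.rpow_neg hL0.le]
    field_simp
  have hLεP : γ ≤ 1 / 2 ∨ P = 0 → L⁻¹ ≤ ε ∨ P = 0 := by
    refine Or.imp_left fun h => ?_
    rw [← Real.rpow_neg_one]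
    calc L ^ (-1 : ℝ) ≤ L ^ (-(2 * γ)) :=
          Real.rpow_le_rpow_of_exponent_le (by linarith) (by linarith)
      _ ≤ ε := le_mul_of_one_le_left (by positivity) hδ1
  have partA : γ ≤ 1 / 2 ∨ P = 0 →
      N ≤ C * δ⁻¹ * V * (1 + δ * L ^ (2 * γ) * P)⁻¹ := by
    intro h
    rw [hεP]
    calc N ≤ 4 * (D * (δ⁻¹ * V)) * (1 + P / ε)⁻¹ :=
          le_mul_inv_one_add_div (by positivity) hε0 hP1 hP0 (hLεP h) b0
            fun hP => b1 P hP hPr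
      _ = 4 * D * δ⁻¹ * V * (1 + P / ε)⁻¹ := by ring
      _ ≤ C * δ⁻¹ * V * (1 + P / ε)⁻¹ := by gcongr
  have partB : 1 / 2 < γ ∧ P ≠ 0 → N ≤ 4 * D * δ⁻¹ ^ 2 * V *
      min ((L * P)⁻¹ + L ^ (-(2 - 2 * γ))) (L ^ (-(10 * η))) := by
    rintro ⟨hγ2, hP⟩
    have hPpos : 0 < P := lt_of_le_of_ne hP0 (Ne.symm hP)
    have hη2 : 10 * η ≤ 2 * γ - 1 := by
      rw [if_neg (not_le.2 hγ2)] at hη₀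
      linarith
    have key := inv_add_div_le_min (by linarith : 1 ≤ L) hδ1 hγ2 hγ' hη2 hPpos (hPL hP)
    calc N ≤ D * (δ⁻¹ * V) * (L⁻¹ + ε / P) := b1 P hPpos hPr
      _ ≤ D * (δ⁻¹ * V) * (2 * δ⁻¹ *
          min ((L * P)⁻¹ + L ^ (-(2 - 2 * γ))) (L ^ (-(10 * η)))) := by gcongr
      _ = 2 * D * δ⁻¹ ^ 2 * V * min ((L * P)⁻¹ + L ^ (-(2 - 2 * γ))) (L ^ (-(10 * η))) := by ring
      _ ≤ _ := by gcongr; norm_num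
  refine ⟨partA, fun h => (partB h).trans (by gcongr), ?_⟩
  have hX : 0 < 1 + δ * L ^ (2 * γ) * P := by positivity
  have hmin : 0 < min (Real.log L ^ 2) (1 + δ * L ^ (2 * γ) * P) := lt_min (by positivity) hX
  by_cases hcase : γ ≤ 1 / 2 ∨ P = 0
  · refine (partA hcase).trans ?_
    gcongr
    exact min_le_right _ _
  · push Not at hcase
    have h3 : δ⁻¹ * L ^ (-(10 * η)) ≤ (1 + (η ^ 2)⁻¹) *
        (min (Real.log L ^ 2) (1 + δ * L ^ (2 * γ) * P))⁻¹ := by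
      refine (inv_mul_rpow_le_inv_log_sq (by linarith) hη (by linarith) hδL).trans ?_
      gcongr
      · linarith
      · exact min_le_left _ _
    calc N ≤ 4 * D * δ⁻¹ ^ 2 * V * L ^ (-(10 * η)) := by
          refine (partB hcase).trans ?_
          gcongr
          exact min_le_right _ _
      _ = 4 * D * δ⁻¹ * V * (δ⁻¹ * L ^ (-(10 * η))) := by ring
      _ ≤ 4 * D * δ⁻¹ * V * ((1 + (η ^ 2)⁻¹) *
          (min (Real.log L ^ 2) (1 + δ * L ^ (2 * γ) * P))⁻¹) := by gcongr
      _ = _ := by rw [hC]; ring
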